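/- In the ABC protocol, let G be a minimal transaction DAG containing two confirmed conflicting transactions and let t_0 be the first transaction confirmed in G during the execution. Then there exists a DAG G' producible by the protocol, in whose genesis the inputs of t_0 are replaced with the outputs of t_0, such that the set of transactions confirmed in G' is the same as in G except that it does not include t_0. In particular, G' contains fewer transactions than G and still contains two confirmed conflicting transactions. -/

import Mathlib

open scoped Classical

/-- An abstract model of a message DAG produced by the ABC protocol.
Transactions, acks and outputs form the messages of the DAG; every output
carries a value and is delegated to a validator; transactions spend outputs
of previous transactions; acks are issued by validators and sign transactions;
messages reference each other acyclically. -/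
structure ABC where
  /-- agents / validators -/
  Val : Type
  /-- transactions of the DAG -/
  Tx : Type
  /-- acks of the DAG -/
  Ack : Type
  /-- transaction outputs -/
  Out : Type
  [fintypeTx : Fintype Tx]
  [fintypeAck : Fintype Ack]
  [fintypeOut : Fintype Out]
  /-- the total money in the system -/
  M : ℚ
  /-- the value (money amount) of an output -/
  value : Out → ℚ
  value_nonneg : ∀ o, 0 ≤ value o
  /-- the (unique) transaction of which `o` is an output -/
  producer : Out → Tx
  /-- `spends t o` : output `o` is an input of transaction `t` -/
  spends : Tx → Out → Prop
  /-- the validator key indicated in a transaction -/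
  txValidator : Tx → Val
  /-- the validator to which an output delegates its stake -/
  delegatedTo : Out → Val
  /-- the genesis transaction -/
  genesis : Tx
  /-- the genesis has no inputs -/
  genesis_no_inputs : ∀ o, ¬ spends genesis o
  /-- outputs of a non-genesis transaction are delegated to the validator
  indicated in the transaction (genesis outputs list the initial validators) -/
  delegated_eq : ∀ o, producer o ≠ genesis → delegatedTo o = txValidator (producer o)
  /-- the output values of a non-genesis transaction sum to its input values -/
  value_conserved : ∀ t, t ≠ genesis →
    (∑ o : Out, if producer o = t then value o else 0) =
      ∑ o : Out, if spends t o then value o else 0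
  /-- the genesis output values sum to the total money `M` -/
  genesis_M : (∑ o : Out, if producer o = genesis then value o else 0) = M
  /-- the validator that issued an ack -/
  ackValidator : Ack → Val
  /-- the set of transactions an ack signs -/
  ackSigns : Ack → Tx → Prop
  /-- hash references between messages (`Sum.inl` = transaction, `Sum.inr` = ack) -/
  ref : Tx ⊕ Ack → Tx ⊕ Ack → Prop
  /-- a transaction references the transactions producing its inputs -/
  ref_inputs : ∀ t o, spends t o → ref (Sum.inl t) (Sum.inl (producer o))
  /-- an ack references the transactions it signs -/
  ref_signs : ∀ a t, ackSigns a t → ref (Sum.inr a) (Sum.inl t)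
  /-- the references form a DAG -/
  ref_acyclic : ∀ m, ¬ Relation.TransGen ref m m
  /-- which agents are honest (the remaining ones form the adversary) -/
  honest : Val → Prop

attribute [instance] ABC.fintypeTx ABC.fintypeAck ABC.fintypeOut

namespace ABC

variable (P : ABC)

/-- messages: transactions and acks -/
abbrev Msg := P.Tx ⊕ P.Ack

/-- `past m` : the set of messages reachable from `m` by following references -/
def past (m : P.Msg) : Set P.Msg := {m' | Relation.ReflTransGen P.ref m m'}

/-- the past of a set of acks -/
def pastA (A : Finset P.Ack) : Set P.Msg := ⋃ a ∈ A, P.past (Sum.inr a)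

/-- output `o` is spent in the message set `S` -/
def SpentIn (S : Set P.Msg) (o : P.Out) : Prop :=
  ∃ t, (Sum.inl t : P.Msg) ∈ S ∧ P.spends t o

/-- `Depends t' t` : transaction `t'` depends on `t`
(reflexive-transitive closure of spending an output of) -/
def Depends : P.Tx → P.Tx → Prop :=
  Relation.ReflTransGen fun t' t => ∃ o, P.spends t' o ∧ P.producer o = t

/-- two transactions share an input -/
def SharesInput (t t' : P.Tx) : Prop := ∃ o, P.spends t o ∧ P.spends t' o

/-- conflicting transactions: two distinct transactions spending a common output
conflict, and conflicts propagate to all transactions depending on them -/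
def Conflict (t₁ t₂ : P.Tx) : Prop :=
  ∃ u₁ u₂, P.Depends t₁ u₁ ∧ P.Depends t₂ u₂ ∧ u₁ ≠ u₂ ∧ P.SharesInput u₁ u₂

/-- the stake delegated to validator `v` in the message set `S`, computed with
respect to a set `C` of (confirmed) transactions: the total value of outputs
of transactions in `C` delegated to `v` and unspent in `S` -/
noncomputable def stakeWith (C : Set P.Tx) (S : Set P.Msg) (v : P.Val) : ℚ :=
  ∑ o : P.Out,
    if P.producer o ∈ C ∧ P.delegatedTo o = v ∧ ¬ P.SpentIn S o then P.value o else 0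

/-- `ConfirmedIn S t` : transaction `t` is confirmed using acks present in the
message set `S`.  The genesis is confirmed from the start; a transaction `t` is
confirmed if the transactions producing its inputs are confirmed and there is a
set of acks `A` (in `S`) whose issuing validators sign `t` and together have
more than `2/3·M` stake delegated in `past A` (stake being computed from
transactions confirmed in `past A`, which is witnessed by the
under-approximation `C` — by nonnegativity of values this is equivalent to the
exact stake exceeding the threshold), and no other transaction in `past A`
shares an input with `t`. -/
inductive ConfirmedIn : Set P.Msg → P.Tx → Prop
  | genesis (S : Set P.Msg) : ConfirmedIn S P.genesis
  | confirm (S : Set P.Msg) (t : P.Tx) (A : Finset P.Ack) (C : Set P.Tx)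
      (hacks : ∀ a ∈ A, (Sum.inr a : P.Msg) ∈ S)
      (hinp : ∀ o, P.spends t o → ConfirmedIn S (P.producer o))
      (hsign : ∀ a ∈ A, P.ackSigns a t)
      (hC : ∀ u ∈ C, ConfirmedIn (P.pastA A) u)
      (hstake : (2 / 3 : ℚ) * P.M <
        ∑ v ∈ A.image P.ackValidator, P.stakeWith C (P.pastA A) v)
      (hnoconf : ∀ t', (Sum.inl t' : P.Msg) ∈ P.pastA A → t' ≠ t → ¬ P.SharesInput t t') :
      ConfirmedIn S t

/-- a transaction is confirmed (in the full DAG) -/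
def Confirmed (t : P.Tx) : Prop := P.ConfirmedIn Set.univ t

/-- the stake delegated to validator `v` in the message set `S`
(Definition "delegated stake" of the paper) -/
noncomputable def stake (S : Set P.Msg) (v : P.Val) : ℚ :=
  P.stakeWith {u | P.ConfirmedIn S u} S v

/-- `A` is a confirming ack set for `t` (the set `A_t` of the paper) -/
def ConfirmsVia (A : Finset P.Ack) (t : P.Tx) : Prop :=
  (∀ o, P.spends t o → P.Confirmed (P.producer o)) ∧
  (∀ a ∈ A, P.ackSigns a t) ∧
  (∃ C : Set P.Tx, (∀ u ∈ C, P.ConfirmedIn (P.pastA A) u) ∧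
    (2 / 3 : ℚ) * P.M < ∑ v ∈ A.image P.ackValidator, P.stakeWith C (P.pastA A) v) ∧
  (∀ t', (Sum.inl t' : P.Msg) ∈ P.pastA A → t' ≠ t → ¬ P.SharesInput t t')

/-- a view: a set of messages closed under references (an agent processes a
message only after having received its whole past) -/
def IsView (V : Set P.Msg) : Prop := ∀ m ∈ V, ∀ m', P.ref m m' → m' ∈ V

/-- honest validators chain their acks: any two acks of an honest validator
are related by references (each ack references the previous one) -/
def HonestChained : Prop :=
  ∀ a₁ a₂ : P.Ack, P.honest (P.ackValidator a₁) → P.ackValidator a₁ = P.ackValidator a₂ →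
    Relation.ReflTransGen P.ref (Sum.inr a₁) (Sum.inr a₂) ∨
      Relation.ReflTransGen P.ref (Sum.inr a₂) (Sum.inr a₁)

/-- an honest validator signs at most one of any pair of conflicting transactions -/
def HonestNoConflictSign : Prop :=
  ∀ a₁ a₂ t₁ t₂, P.honest (P.ackValidator a₁) → P.ackValidator a₁ = P.ackValidator a₂ →
    P.ackSigns a₁ t₁ → P.ackSigns a₂ t₂ → t₁ ≠ t₂ → ¬ P.Conflict t₁ t₂

/-- an execution order: a total ordering of the messages (given by injective
time stamps) respecting message dependence -/
structure Execution where
  time : P.Msg → ℕ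
  inj : Function.Injective time
  respects : ∀ m m', P.ref m m' → time m' < time m

/-- the messages issued up to time `n` in execution `E` -/
def prefixAt (E : P.Execution) (n : ℕ) : Set P.Msg := {m | E.time m ≤ n}

/-- the value of a transaction: the sum of the values of its outputs -/
noncomputable def txValue (t : P.Tx) : ℚ :=
  ∑ o : P.Out, if P.producer o = t then P.value o else 0

/-- the total value of the inputs of `t` that are outputs delegated to the
adversary (the quantity `m_{t,A}` of the paper) -/
noncomputable def advInputValue (t : P.Tx) : ℚ :=
  ∑ o : P.Out, if P.spends t o ∧ ¬ P.honest (P.delegatedTo o) then P.value o else 0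

/-- the paper's adversary-stake accounting, at the set `S` of messages issued
so far: the genesis outputs delegated to the adversary, minus `m_{t,A}` for
every honestly delegated transaction `t` already confirmed, plus
`m_t - m_{t,A}` for every adversary-delegated transaction `t` already issued -/
noncomputable def advStake (S : Set P.Msg) : ℚ :=
  (∑ o : P.Out,
      if P.producer o = P.genesis ∧ ¬ P.honest (P.delegatedTo o) then P.value o else 0)
    - (∑ t : P.Tx,
        if t ≠ P.genesis ∧ P.honest (P.txValidator t) ∧ P.ConfirmedIn S t
        then P.advInputValue t else 0)
    + ∑ t : P.Tx,
        if t ≠ P.genesis ∧ ¬ P.honest (P.txValidator t) ∧ (Sum.inl t : P.Msg) ∈ S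
        then P.txValue t - P.advInputValue t else 0

/-- at any time, less than one-third of the total money is delegated to the
adversary -/
def AdvBounded (E : P.Execution) : Prop :=
  ∀ n : ℕ, P.advStake (P.prefixAt E n) < P.M / 3

/-- the DAG can be produced by the protocol: honest validators chain their
acks and never sign conflicting transactions, and the adversary's stake stays
below `M/3` throughout some execution producing the DAG -/
def Producible : Prop :=
  P.HonestChained ∧ P.HonestNoConflictSign ∧ ∃ E : P.Execution, P.AdvBounded E

/-- the DAG contains two confirmed conflicting transactions -/
def HasDoubleSpend : Prop :=
  ∃ t₁ t₂, P.Confirmed t₁ ∧ P.Confirmed t₂ ∧ P.Conflict t₁ t₂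

/-- the time of the latest ack of the ack set `A` -/
noncomputable def latestAck (E : P.Execution) (A : Finset P.Ack) : ℕ :=
  A.sup fun a => E.time (Sum.inr a)

/-- `t₀` is the first transaction confirmed during the execution `E`,
exhibited by the confirming ack set `A₀` whose latest ack is minimal -/
def FirstConfirmed (E : P.Execution) (t₀ : P.Tx) (A₀ : Finset P.Ack) : Prop :=
  t₀ ≠ P.genesis ∧ P.ConfirmsVia A₀ t₀ ∧
    ∀ (t : P.Tx) (A : Finset P.Ack), t ≠ P.genesis → P.ConfirmsVia A t →
      P.latestAck E A₀ ≤ P.latestAck E A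

/-- a transaction is accepted (by an honest agent) if it is confirmed in some
view -/
def Accepted (t : P.Tx) : Prop := ∃ V, P.IsView V ∧ P.ConfirmedIn V t

/-- Agreement: a transaction confirmed in the view of some honest agent is
confirmed in the view of any honest agent having received (at least) the same
messages — the acks `A_t` are a transferable proof of confirmation, so every
honest agent will accept the same transaction — and no two conflicting
transactions are ever accepted -/
def Agreement : Prop :=
  (∀ (t : P.Tx) (V V' : Set P.Msg), P.IsView V → P.IsView V' → V ⊆ V' →
      P.ConfirmedIn V t → P.ConfirmedIn V' t) ∧
    ∀ t t', P.Conflict t t' → ¬ (P.Accepted t ∧ P.Accepted t')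

/-- Validity: a transaction without any conflicting transaction is accepted by
the honest agents (it is confirmed once all messages are delivered) -/
def Validity : Prop :=
  ∀ t : P.Tx, (∀ t', t' ≠ t → ¬ P.Conflict t t') → P.Confirmed t

/-- Honest-Termination: if a transaction without any conflicting transaction is
observed by an honest agent, then after receiving further messages the agent
accepts it -/
def HonestTermination : Prop :=
  ∀ t : P.Tx, (∀ t', t' ≠ t → ¬ P.Conflict t t') →
    ∀ V, P.IsView V → (Sum.inl t : P.Msg) ∈ V →
      ∃ V', P.IsView V' ∧ V ⊆ V' ∧ P.ConfirmedIn V' t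

/-- every honest validator signs every transaction that has no conflicting
alternative -/
def HonestRespond : Prop :=
  ∀ t : P.Tx, (∀ t', t' ≠ t → ¬ P.Conflict t t') →
    ∀ v, P.honest v → ∃ a, P.ackValidator a = v ∧ P.ackSigns a t

end ABC

namespace ABC

/-- confirmation with a derivation of height at most `r` -/
def CR (P : ABC) : ℕ → Set P.Msg → P.Tx → Prop
  | 0, _, t => t = P.genesis
  | r + 1, S, t => t = P.genesis ∨ ∃ (A : Finset P.Ack) (C : Set P.Tx),
      (∀ a ∈ A, (Sum.inr a : P.Msg) ∈ S) ∧
      (∀ o, P.spends t o → CR P r S (P.producer o)) ∧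
      (∀ a ∈ A, P.ackSigns a t) ∧
      (∀ u ∈ C, CR P r (P.pastA A) u) ∧
      ((2 / 3 : ℚ) * P.M < ∑ v ∈ A.image P.ackValidator, P.stakeWith C (P.pastA A) v) ∧
      (∀ t', (Sum.inl t' : P.Msg) ∈ P.pastA A → t' ≠ t → ¬ P.SharesInput t t')

/-- a certificate for `t` of height `r` -/
def Cert (P : ABC) (r : ℕ) (A : Finset P.Ack) (t : P.Tx) : Prop :=
  (∀ a ∈ A, P.ackSigns a t) ∧
  (∃ C : Set P.Tx, (∀ u ∈ C, P.CR r (P.pastA A) u) ∧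
    (2 / 3 : ℚ) * P.M < ∑ v ∈ A.image P.ackValidator, P.stakeWith C (P.pastA A) v) ∧
  (∀ t', (Sum.inl t' : P.Msg) ∈ P.pastA A → t' ≠ t → ¬ P.SharesInput t t')

theorem CR_genesis (P : ABC) (r : ℕ) (S : Set P.Msg) : P.CR r S P.genesis := by
  cases r with
  | zero => rfl
  | succ r => exact Or.inl rfl

theorem CR_succ (P : ABC) (r : ℕ) : ∀ (S : Set P.Msg) (t : P.Tx),
    P.CR r S t → P.CR (r + 1) S t := by
  induction r with
  | zero => intro S t h; exact Or.inl h
  | succ r ih =>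
    intro S t h
    rcases h with h | ⟨A, C, h1, h2, h3, h4, h5, h6⟩
    · exact Or.inl h
    · exact Or.inr ⟨A, C, h1, fun o ho => ih _ _ (h2 o ho), h3, fun u hu => ih _ _ (h4 u hu), h5, h6⟩

theorem CR_mono (P : ABC) {r r' : ℕ} (hr : r ≤ r') (S : Set P.Msg) (t : P.Tx)
    (h : P.CR r S t) : P.CR r' S t := by
  induction hr with
  | refl => exact h
  | step _ ih => exact P.CR_succ _ _ _ ih

theorem CR_inputs (P : ABC) (r : ℕ) (S : Set P.Msg) (t : P.Tx) (h : P.CR r S t)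
    (o : P.Out) (ho : P.spends t o) : P.CR r S (P.producer o) := by
  cases r with
  | zero => cases h; exact absurd ho (P.genesis_no_inputs o)
  | succ r =>
    rcases h with rfl | ⟨A, C, h1, h2, h3, h4, h5, h6⟩
    · exact absurd ho (P.genesis_no_inputs o)
    · exact P.CR_succ _ _ _ (h2 o ho)

theorem CR_cert (P : ABC) (r : ℕ) (S : Set P.Msg) (t : P.Tx) (h : P.CR r S t)
    (ht : t ≠ P.genesis) :
    ∃ r' A, r' < r ∧ (∀ a ∈ A, (Sum.inr a : P.Msg) ∈ S) ∧ P.Cert r' A t := by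
  cases r with
  | zero => exact absurd h ht
  | succ r =>
    rcases h with h | ⟨A, C, h1, h2, h3, h4, h5, h6⟩
    · exact absurd h ht
    · exact ⟨r, A, Nat.lt_succ_self r, h1, h3, ⟨C, h4, h5⟩, h6⟩

theorem exists_CR (P : ABC) (S : Set P.Msg) (t : P.Tx) (h : P.ConfirmedIn S t) :
    ∃ r, P.CR r S t := by
  induction h with
  | genesis S => exact ⟨0, rfl⟩
  | confirm S t A C hacks hinp hsign hC hstake hno ih1 ih2 =>
    have e1 : ∃ R, ∀ o, P.spends t o → P.CR R S (P.producer o) := by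
      choose f hf using ih1
      refine ⟨Finset.univ.sup fun o => if h : P.spends t o then f o h else 0, fun o ho => ?_⟩
      refine P.CR_mono ?_ _ _ (hf o ho)
      have := Finset.le_sup (f := fun o => if h : P.spends t o then f o h else 0)
        (Finset.mem_univ o)
      simpa [ho] using this
    have e2 : ∃ R, ∀ u ∈ C, P.CR R (P.pastA A) u := by
      choose f hf using ih2
      refine ⟨Finset.univ.sup fun o => if h : o ∈ C then f o h else 0, fun o ho => ?_⟩
      refine P.CR_mono ?_ _ _ (hf o ho)
      have := Finset.le_sup (f := fun o => if h : o ∈ C then f o h else 0)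
        (Finset.mem_univ o)
      simpa [ho] using this
    obtain ⟨R1, h1⟩ := e1
    obtain ⟨R2, h2⟩ := e2
    exact ⟨max R1 R2 + 1, Or.inr ⟨A, C, hacks,
      fun o ho => P.CR_mono (le_max_left _ _) _ _ (h1 o ho), hsign,
      fun u hu => P.CR_mono (le_max_right _ _) _ _ (h2 u hu), hstake, hno⟩⟩

theorem ConfirmedIn_inputs (P : ABC) (S : Set P.Msg) (t : P.Tx) (h : P.ConfirmedIn S t)
    (o : P.Out) (ho : P.spends t o) : P.ConfirmedIn S (P.producer o) := by
  cases h with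
  | genesis => exact absurd ho (P.genesis_no_inputs o)
  | confirm _ _ A C hacks hinp hsign hC hstake hno => exact hinp o ho

theorem confirmed_cert (P : ABC) (S : Set P.Msg) (t : P.Tx) (h : P.ConfirmedIn S t)
    (ht : t ≠ P.genesis) :
    ∃ r A, (∀ a ∈ A, (Sum.inr a : P.Msg) ∈ S) ∧ P.Cert r A t := by
  obtain ⟨r, hr⟩ := P.exists_CR S t h
  obtain ⟨r', A, -, h1, h2⟩ := P.CR_cert r S t hr ht
  exact ⟨r', A, h1, h2⟩

theorem M_nonneg (P : ABC) : 0 ≤ P.M := by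
  rw [← P.genesis_M]
  refine Finset.sum_nonneg fun o _ => ?_
  split_ifs
  · exact P.value_nonneg o
  · exact le_rfl

theorem Cert.nonempty {P : ABC} {r : ℕ} {A : Finset P.Ack} {t : P.Tx} (h : P.Cert r A t) :
    A.Nonempty := by
  rw [Finset.nonempty_iff_ne_empty]
  rintro rfl
  obtain ⟨-, ⟨C, -, h2⟩, -⟩ := h
  have := P.M_nonneg
  simp at h2
  linarith

theorem mem_pastA (P : ABC) (A : Finset P.Ack) (m : P.Msg) :
    m ∈ P.pastA A ↔ ∃ a ∈ A, Relation.ReflTransGen P.ref (Sum.inr a) m := by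
  simp [pastA, past]

theorem pastA_sub (P : ABC) (A B : Finset P.Ack) (h : ∀ a ∈ B, (Sum.inr a : P.Msg) ∈ P.pastA A) :
    P.pastA B ⊆ P.pastA A := by
  intro m hm
  rw [mem_pastA] at hm ⊢
  obtain ⟨b, hb, hbm⟩ := hm
  obtain ⟨a, ha, hab⟩ := (P.mem_pastA _ _).1 (h b hb)
  exact ⟨a, ha, hab.trans hbm⟩

theorem Cert.mem_past {P : ABC} {r : ℕ} {A : Finset P.Ack} {t : P.Tx} (h : P.Cert r A t) :
    (Sum.inl t : P.Msg) ∈ P.pastA A := by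
  obtain ⟨a, ha⟩ := h.nonempty
  rw [mem_pastA]
  exact ⟨a, ha, Relation.ReflTransGen.single (P.ref_signs a t (h.1 a ha))⟩

theorem time_le {P : ABC} (E : P.Execution) {m m' : P.Msg}
    (h : Relation.ReflTransGen P.ref m m') : E.time m' ≤ E.time m := by
  induction h with
  | refl => exact le_rfl
  | tail _ h ih => exact (E.respects _ _ h).le.trans ih

theorem time_pastA {P : ABC} (E : P.Execution) {A : Finset P.Ack} {n : ℕ}
    (hA : ∀ a ∈ A, E.time (Sum.inr a) ≤ n) {m : P.Msg} (h : m ∈ P.pastA A) :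
    E.time m ≤ n := by
  obtain ⟨a, ha, hm⟩ := (P.mem_pastA _ _).1 h
  exact (time_le E hm).trans (hA a ha)

/-- transactions in the past of acks are strictly older than the newest ack -/
theorem tx_time_lt {P : ABC} (E : P.Execution) {A : Finset P.Ack} {n : ℕ}
    (hA : ∀ a ∈ A, E.time (Sum.inr a) ≤ n) {t : P.Tx} (h : (Sum.inl t : P.Msg) ∈ P.pastA A) :
    E.time (Sum.inl t) < n := by
  obtain ⟨a, ha, hm⟩ := (P.mem_pastA _ _).1 h
  rcases lt_or_eq_of_le ((time_le E hm).trans (hA a ha)) with h1 | h1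
  · exact h1
  · have h2 : E.time (Sum.inl t) = E.time (Sum.inr a) :=
      le_antisymm (time_le E hm) (h1 ▸ hA a ha)
    exact absurd (E.inj h2) (by simp)

theorem le_latest {P : ABC} (E : P.Execution) (A : Finset P.Ack) :
    ∀ a ∈ A, E.time (Sum.inr a) ≤ P.latestAck E A := fun a ha =>
  Finset.le_sup (f := fun a => E.time (Sum.inr a)) ha

theorem latest_le {P : ABC} (E : P.Execution) {A : Finset P.Ack} {n : ℕ}
    (hA : ∀ a ∈ A, E.time (Sum.inr a) ≤ n) : P.latestAck E A ≤ n :=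
  Finset.sup_le hA

/-- conservation of an arbitrary weight over a conflict-free, input-closed set -/
theorem cons_sum (P : ABC) (W : Set P.Tx) (f : P.Out → ℚ)
    (hcf : ∀ t ∈ W, ∀ t' ∈ W, t ≠ t' → ¬ P.SharesInput t t')
    (hin : ∀ t ∈ W, ∀ o, P.spends t o → P.producer o ∈ W) :
    (∑ o : P.Out, if P.producer o ∈ W ∧ ¬ (∃ t ∈ W, P.spends t o) then f o else 0) =
      ∑ t : P.Tx, if t ∈ W then (∑ o : P.Out, if P.producer o = t then f o else 0)
        - (∑ o : P.Out, if P.spends t o then f o else 0) else 0 := by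
  have h1 : ∀ t : P.Tx, (if t ∈ W then (∑ o : P.Out, if P.producer o = t then f o else 0)
        - (∑ o : P.Out, if P.spends t o then f o else 0) else 0) =
      ∑ o : P.Out, ((if P.producer o = t then (if t ∈ W then f o else 0) else 0)
        - (if t ∈ W ∧ P.spends t o then f o else 0)) := by
    intro t
    by_cases ht : t ∈ W
    · simp [ht, Finset.sum_sub_distrib]
    · simp [ht]
  rw [Finset.sum_congr rfl (fun t _ => h1 t), Finset.sum_comm]
  refine Finset.sum_congr rfl fun o _ => ?_
  rw [Finset.sum_sub_distrib, Finset.sum_ite_eq]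
  by_cases hs : ∃ t ∈ W, P.spends t o
  · obtain ⟨t, ht, hto⟩ := hs
    have h2 : (∑ x : P.Tx, if x ∈ W ∧ P.spends x o then f o else 0) = f o := by
      rw [Finset.sum_eq_single t]
      · simp [ht, hto]
      · intro b _ hb
        rw [if_neg]
        rintro ⟨hb1, hb2⟩
        exact hcf b hb1 t ht hb ⟨o, hb2, hto⟩
      · simp
    rw [h2, if_neg (fun h => h.2 ⟨t, ht, hto⟩)]
    simp [hin t ht o hto]
  · have h2 : (∑ x : P.Tx, if x ∈ W ∧ P.spends x o then f o else 0) = 0 := by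
      refine Finset.sum_eq_zero fun x _ => ?_
      rw [if_neg]
      rintro ⟨hb1, hb2⟩
      exact hs ⟨x, hb1, hb2⟩
    rw [h2]
    simp [hs]

/-- total money in a consistent state is `M` -/
theorem total_M (P : ABC) (W : Set P.Tx) (hg : P.genesis ∈ W)
    (hcf : ∀ t ∈ W, ∀ t' ∈ W, t ≠ t' → ¬ P.SharesInput t t')
    (hin : ∀ t ∈ W, ∀ o, P.spends t o → P.producer o ∈ W) :
    (∑ o : P.Out, if P.producer o ∈ W ∧ ¬ (∃ t ∈ W, P.spends t o) then P.value o else 0) =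
      P.M := by
  rw [P.cons_sum W P.value hcf hin, Finset.sum_eq_single P.genesis]
  · simp only [hg, if_true, P.genesis_M, P.genesis_no_inputs, if_false, Finset.sum_const_zero,
      sub_zero]
  · intro t _ ht
    rw [P.value_conserved t ht]
    simp
  · simp

theorem advIn_nonneg (P : ABC) (t : P.Tx) : 0 ≤ P.advInputValue t := by
  refine Finset.sum_nonneg fun o _ => ?_
  split_ifs
  · exact P.value_nonneg o
  · exact le_rfl

theorem advIn_le (P : ABC) (t : P.Tx) (ht : t ≠ P.genesis) :
    P.advInputValue t ≤ P.txValue t := by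
  unfold advInputValue txValue
  rw [P.value_conserved t ht]
  refine Finset.sum_le_sum fun o _ => ?_
  have := P.value_nonneg o
  by_cases h1 : P.spends t o <;> by_cases h2 : P.honest (P.delegatedTo o) <;> simp [h1, h2, this]

/-- adversarial unspent outputs of a consistent state are bounded by the accounting -/
theorem adv_le (P : ABC) (W : Set P.Tx) (S : Set P.Msg) (hg : P.genesis ∈ W)
    (hcf : ∀ t ∈ W, ∀ t' ∈ W, t ≠ t' → ¬ P.SharesInput t t')
    (hin : ∀ t ∈ W, ∀ o, P.spends t o → P.producer o ∈ W)
    (hS : ∀ t ∈ W, t ≠ P.genesis → (Sum.inl t : P.Msg) ∈ S)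
    (hC : ∀ t, P.ConfirmedIn S t → t ∈ W) :
    (∑ o : P.Out, if P.producer o ∈ W ∧ ¬ (∃ t ∈ W, P.spends t o) then
        (if ¬ P.honest (P.delegatedTo o) then P.value o else 0) else 0) ≤ P.advStake S := by
  rw [P.cons_sum W _ hcf hin]
  have hgen : (∑ o : P.Out,
      if P.producer o = P.genesis ∧ ¬ P.honest (P.delegatedTo o) then P.value o else 0) =
      ∑ t : P.Tx, if t = P.genesis then (∑ o : P.Out,
      if P.producer o = P.genesis ∧ ¬ P.honest (P.delegatedTo o) then P.value o else 0) else 0 := by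
    simp
  unfold advStake
  rw [hgen, ← Finset.sum_sub_distrib, ← Finset.sum_add_distrib]
  refine Finset.sum_le_sum fun t _ => ?_
  have hin' : (∑ o : P.Out, if P.spends t o then
      (if ¬ P.honest (P.delegatedTo o) then P.value o else 0) else 0) = P.advInputValue t := by
    unfold advInputValue
    refine Finset.sum_congr rfl fun o _ => ?_
    rw [ite_and]
  rw [hin']
  by_cases ht : t = P.genesis
  · subst ht
    have h0 : P.advInputValue P.genesis = 0 := by
      simp [advInputValue, P.genesis_no_inputs]
    rw [h0]
    simp only [hg, if_true, ne_eq, not_true_eq_false, false_and, if_false, sub_zero, add_zero]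
    refine le_of_eq (Finset.sum_congr rfl fun o _ => ?_)
    rw [ite_and]
  · have a1 := P.advIn_nonneg t
    have a2 := P.advIn_le t ht
    have hc := hC t
    have hs := fun h => hS t h ht
    have hout : (∑ o : P.Out, if P.producer o = t then
        (if ¬ P.honest (P.delegatedTo o) then P.value o else 0) else 0) =
        if P.honest (P.txValidator t) then 0 else P.txValue t := by
      have : ∀ o : P.Out, (if P.producer o = t then
          (if ¬ P.honest (P.delegatedTo o) then P.value o else 0) else 0) =
          if P.honest (P.txValidator t) then 0 else
            (if P.producer o = t then P.value o else 0) := by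
        intro o
        by_cases ho : P.producer o = t
        · have := P.delegated_eq o (by rw [ho]; exact ht)
          rw [ho] at this
          rw [this]
          by_cases hh : P.honest (P.txValidator t) <;> simp [ho, hh]
        · simp [ho]
      rw [Finset.sum_congr rfl (fun o _ => this o)]
      unfold txValue
      by_cases hh : P.honest (P.txValidator t) <;> simp [hh]
    rw [hout]
    by_cases hW : t ∈ W
    · have hs' := hs hW
      by_cases hh : P.honest (P.txValidator t)
      · by_cases hcc : P.ConfirmedIn S t <;> simp [hW, ht, hh, hcc, a1]
      · simp [hW, ht, hh, hs']
    · have hcc : ¬ P.ConfirmedIn S t := fun h => hW (hc h)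
      by_cases hh : P.honest (P.txValidator t)
      · simp [hW, ht, hh, hcc]
      · by_cases hss : (Sum.inl t : P.Msg) ∈ S <;> simp [hW, ht, hh, hss, a2]

theorem stake_sum (P : ABC) (C : Set P.Tx) (S : Set P.Msg) (V : Finset P.Val) :
    ∑ v ∈ V, P.stakeWith C S v = ∑ o : P.Out,
      if P.producer o ∈ C ∧ P.delegatedTo o ∈ V ∧ ¬ P.SpentIn S o then P.value o else 0 := by
  unfold stakeWith
  rw [Finset.sum_comm]
  refine Finset.sum_congr rfl fun o _ => ?_
  by_cases h1 : P.producer o ∈ C <;> by_cases h2 : P.SpentIn S o <;>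
    simp [h1, h2]

/-- comparability of two certificates -/
def Comp (P : ABC) (t : P.Tx) (A : Finset P.Ack) (t' : P.Tx) (A' : Finset P.Ack) : Prop :=
  (Sum.inl t : P.Msg) ∈ P.pastA A' ∨ (Sum.inl t' : P.Msg) ∈ P.pastA A

/-- key of a certificate -/
noncomputable def key {P : ABC} (E : P.Execution) (r : ℕ) (A : Finset P.Ack) : ℕ ×ₗ ℕ :=
  toLex (P.latestAck E A, r)

theorem comp_noshare {P : ABC} {r r' : ℕ} {A A' : Finset P.Ack} {t t' : P.Tx}
    (h : P.Cert r A t) (h' : P.Cert r' A' t') (hc : P.Comp t A t' A') (hne : t ≠ t') :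
    ¬ P.SharesInput t t' := by
  rcases hc with hc | hc
  · rintro ⟨o, ho, ho'⟩
    exact h'.2.2 t hc hne ⟨o, ho', ho⟩
  · exact h.2.2 t' hc (Ne.symm hne)

theorem CR_key {P : ABC} (E : P.Execution) {r : ℕ} {A : Finset P.Ack} {u : P.Tx}
    (h : P.CR r (P.pastA A) u) (hu : u ≠ P.genesis) :
    ∃ s B, P.Cert s B u ∧ key E s B < key E r A ∧ P.pastA B ⊆ P.pastA A := by
  obtain ⟨s, B, hs, hB, hc⟩ := P.CR_cert r _ u h hu
  refine ⟨s, B, hc, ?_, P.pastA_sub A B hB⟩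
  have h1 : P.latestAck E B ≤ P.latestAck E A :=
    latest_le E fun b hb => time_pastA E (le_latest E A) (hB b hb)
  unfold key
  rw [Prod.Lex.toLex_lt_toLex]
  rcases lt_or_eq_of_le h1 with h | h
  · exact Or.inl h
  · exact Or.inr ⟨h, hs⟩

theorem comp_step (P : ABC) (E : P.Execution) (hchain : P.HonestChained) (hadv : P.AdvBounded E)
    (r r' : ℕ) (A A' : Finset P.Ack) (t t' : P.Tx)
    (hc : P.Cert r A t) (hc' : P.Cert r' A' t')
    (hle : key E r' A' ≤ key E r A)
    (H1 : ∀ s s' B B' u u', P.Cert s B u → P.Cert s' B' u' → key E s B < key E r A →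
      key E s' B' < key E r A → P.Comp u B u' B')
    (H2 : ∀ s B u, P.Cert s B u → key E s B < key E r' A' → P.Comp t A u B)
    (H3 : ∀ s B u, P.Cert s B u → key E s B < key E r A → P.Comp u B t' A') :
    P.Comp t A t' A' := by
  by_contra hno
  obtain ⟨hn1, hn2⟩ := not_or.1 hno
  set S := P.pastA A with hSdef
  set S' := P.pastA A' with hSdef'
  -- everything confirmed in one past is visible in the other
  have hCS' : ∀ u, u ≠ P.genesis → P.CR r S u → (Sum.inl u : P.Msg) ∈ S' := by
    intro u hu h
    obtain ⟨s, B, hB, hk, hsub⟩ := CR_key E h hu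
    rcases H3 s B u hB hk with h | h
    · exact h
    · exact absurd (hsub h) hn2
  have hC'S : ∀ u, u ≠ P.genesis → P.CR r' S' u → (Sum.inl u : P.Msg) ∈ S := by
    intro u hu h
    obtain ⟨s, B, hB, hk, hsub⟩ := CR_key E h hu
    rcases H2 s B u hB hk with h | h
    · exact absurd (hsub h) hn1
    · exact h
  let K : Set P.Tx := {u | P.CR r S u ∨ P.CR r' S' u}
  have hKcert : ∀ u ∈ K, u ≠ P.genesis → ∃ s B, P.Cert s B u ∧ key E s B < key E r A ∧
      (P.pastA B ⊆ S ∨ P.pastA B ⊆ S') := by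
    rintro u (h | h) hu
    · obtain ⟨s, B, hB, hk, hsub⟩ := CR_key E h hu
      exact ⟨s, B, hB, hk, Or.inl hsub⟩
    · obtain ⟨s, B, hB, hk, hsub⟩ := CR_key E h hu
      exact ⟨s, B, hB, hk.trans_le hle, Or.inr hsub⟩
  have hKS : ∀ u ∈ K, u ≠ P.genesis → (Sum.inl u : P.Msg) ∈ S ∧ (Sum.inl u : P.Msg) ∈ S' := by
    rintro u (h | h) hu
    · obtain ⟨s, B, hB, hk, hsub⟩ := CR_key E h hu
      exact ⟨hsub hB.mem_past, hCS' u hu h⟩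
    · obtain ⟨s, B, hB, hk, hsub⟩ := CR_key E h hu
      exact ⟨hC'S u hu h, hsub hB.mem_past⟩
  have hKg : P.genesis ∈ K := Or.inl (P.CR_genesis _ _)
  have hKin : ∀ t ∈ K, ∀ o, P.spends t o → P.producer o ∈ K := by
    rintro u (h | h) o ho
    · exact Or.inl (P.CR_inputs _ _ _ h o ho)
    · exact Or.inr (P.CR_inputs _ _ _ h o ho)
  -- the critical time
  set N := P.latestAck E A with hN
  have hQ : ∃ m, N ≤ m ∨ ∃ x, x ≠ P.genesis ∧ P.ConfirmedIn (P.prefixAt E m) x ∧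
      (Sum.inl x : P.Msg) ∉ S ∧ (Sum.inl x : P.Msg) ∉ S' := ⟨N, Or.inl le_rfl⟩
  obtain ⟨m, hm, hmmin⟩ : ∃ m, (N ≤ m ∨ ∃ x, x ≠ P.genesis ∧ P.ConfirmedIn (P.prefixAt E m) x ∧
      (Sum.inl x : P.Msg) ∉ S ∧ (Sum.inl x : P.Msg) ∉ S') ∧
      ∀ k < m, ¬ (N ≤ k ∨ ∃ x, x ≠ P.genesis ∧ P.ConfirmedIn (P.prefixAt E k) x ∧
      (Sum.inl x : P.Msg) ∉ S ∧ (Sum.inl x : P.Msg) ∉ S') :=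
    ⟨Nat.find hQ, Nat.find_spec hQ, fun k hk => Nat.find_min hQ hk⟩
  have hmN : m ≤ N := by
    by_contra h
    exact hmmin N (not_le.1 h) (Or.inl le_rfl)
  have hprek : ∀ k < N, ∀ x, x ≠ P.genesis → P.ConfirmedIn (P.prefixAt E k) x →
      ∃ s B, P.Cert s B x ∧ (∀ b ∈ B, E.time (Sum.inr b) ≤ k) ∧ key E s B < key E r A := by
    intro k hk x hx hcx
    obtain ⟨s, B, hB, hcB⟩ := P.confirmed_cert _ x hcx hx
    refine ⟨s, B, hcB, hB, ?_⟩
    unfold key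
    rw [Prod.Lex.toLex_lt_toLex]
    exact Or.inl ((latest_le E hB).trans_lt hk)
  have hKm : ∀ u ∈ K, u ≠ P.genesis → E.time (Sum.inl u) < m := by
    intro u hu hug
    by_cases hNm : N ≤ m
    · exact (tx_time_lt E (le_latest E A) (hKS u hu hug).1).trans_le hNm
    · rcases hm with hm | ⟨x, hx, hcx, hx1, hx2⟩
      · exact absurd hm hNm
      · obtain ⟨s, B, hB, hBt, hk⟩ := hprek m (not_le.1 hNm) x hx hcx
        obtain ⟨s2, B2, hB2, hk2, hsub⟩ := hKcert u hu hug
        rcases H1 s s2 B B2 x u hB hB2 hk hk2 with h | h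
        · rcases hsub with hsub | hsub
          · exact absurd (hsub h) hx1
          · exact absurd (hsub h) hx2
        · exact tx_time_lt E hBt h
  have hmpos : 0 < m := by
    by_cases hNm : N ≤ m
    · exact (Nat.zero_le _).trans_lt ((tx_time_lt E (le_latest E A) hc.mem_past).trans_le hNm)
    · rcases hm with hm | ⟨x, hx, hcx, hx1, hx2⟩
      · exact absurd hm hNm
      · obtain ⟨s, B, hB, hBt, hk⟩ := hprek m (not_le.1 hNm) x hx hcx
        exact (Nat.zero_le _).trans_lt (tx_time_lt E hBt hB.mem_past)
  obtain ⟨n, rfl⟩ : ∃ n, m = n + 1 := ⟨m - 1, by omega⟩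
  have hnN : n < N := by omega
  have hnS : ∀ x, x ≠ P.genesis → P.ConfirmedIn (P.prefixAt E n) x →
      (Sum.inl x : P.Msg) ∈ S ∨ (Sum.inl x : P.Msg) ∈ S' := by
    intro x hx hcx
    by_contra h
    obtain ⟨h1, h2⟩ := not_or.1 h
    exact hmmin n (Nat.lt_succ_self n) (Or.inr ⟨x, hx, hcx, h1, h2⟩)
  let W : Set P.Tx := {u | u ∈ K ∨ P.ConfirmedIn (P.prefixAt E n) u}
  have hWcert : ∀ u ∈ W, u ≠ P.genesis → ∃ s B, P.Cert s B u ∧ key E s B < key E r A := by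
    rintro u (h | h) hu
    · obtain ⟨s, B, h1, h2, -⟩ := hKcert u h hu
      exact ⟨s, B, h1, h2⟩
    · obtain ⟨s, B, h1, -, h2⟩ := hprek n hnN u hu h
      exact ⟨s, B, h1, h2⟩
  have hWcf : ∀ u ∈ W, ∀ u' ∈ W, u ≠ u' → ¬ P.SharesInput u u' := by
    intro u hu u' hu' hne
    by_cases hg : u = P.genesis
    · rintro ⟨o, ho, -⟩
      rw [hg] at ho
      exact P.genesis_no_inputs o ho
    by_cases hg' : u' = P.genesis
    · rintro ⟨o, -, ho⟩
      rw [hg'] at ho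
      exact P.genesis_no_inputs o ho
    obtain ⟨s, B, h1, h2⟩ := hWcert u hu hg
    obtain ⟨s', B', h1', h2'⟩ := hWcert u' hu' hg'
    exact comp_noshare h1 h1' (H1 s s' B B' u u' h1 h1' h2 h2') hne
  have hWin : ∀ t ∈ W, ∀ o, P.spends t o → P.producer o ∈ W := by
    rintro u (h | h) o ho
    · exact Or.inl (hKin u h o ho)
    · exact Or.inr (P.ConfirmedIn_inputs _ _ h o ho)
  have hWpre : ∀ u ∈ W, u ≠ P.genesis → (Sum.inl u : P.Msg) ∈ P.prefixAt E n := by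
    rintro u (h | h) hu
    · exact Nat.lt_succ_iff.1 (hKm u h hu)
    · obtain ⟨s, B, h1, h2, -⟩ := hprek n hnN u hu h
      exact (tx_time_lt E h2 h1.mem_past).le
  have hWS : ∀ u ∈ W, u ≠ P.genesis → (Sum.inl u : P.Msg) ∈ S ∨ (Sum.inl u : P.Msg) ∈ S' := by
    rintro u (h | h) hu
    · exact Or.inl (hKS u h hu).1
    · exact hnS u hu h
  have hKW : ∀ u, u ∈ K → u ∈ W := fun u hu => Or.inl hu
  have hPW : ∀ u, P.ConfirmedIn (P.prefixAt E n) u → u ∈ W := fun u hu => Or.inr hu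
  have hCK : ∀ u, P.CR r S u → u ∈ K := fun u hu => Or.inl hu
  have hCK' : ∀ u, P.CR r' S' u → u ∈ K := fun u hu => Or.inr hu
  clear_value W
  clear_value K
  have hadvW := P.adv_le W (P.prefixAt E n) (hKW _ hKg) hWcf hWin hWpre hPW
  have hadvn := hadv n
  have htot := P.total_M K hKg
    (fun u hu u' hu' => hWcf u (hKW u hu) u' (hKW u' hu')) hKin
  obtain ⟨hs, ⟨C, hC, hst⟩, -⟩ := hc
  obtain ⟨hs', ⟨C', hC', hst'⟩, -⟩ := hc'
  -- no honest validator in both quorums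
  have hdis : ∀ v, v ∈ A.image P.ackValidator → v ∈ A'.image P.ackValidator → ¬ P.honest v := by
    intro v hv hv' hh
    obtain ⟨a, ha, rfl⟩ := Finset.mem_image.1 hv
    obtain ⟨a', ha', he⟩ := Finset.mem_image.1 hv'
    rcases hchain a a' hh he.symm with h | h
    · refine hn2 ((P.mem_pastA _ _).2 ⟨a, ha, h.tail (P.ref_signs a' t' (hs' a' ha'))⟩)
    · refine hn1 ((P.mem_pastA _ _).2 ⟨a', ha', h.tail (P.ref_signs a t (hs a ha))⟩)
  have hmain : (∑ v ∈ A.image P.ackValidator, P.stakeWith C S v) +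
      (∑ v ∈ A'.image P.ackValidator, P.stakeWith C' S' v) ≤
      (∑ o : P.Out, if P.producer o ∈ K ∧ ¬ (∃ t ∈ K, P.spends t o) then P.value o else 0) +
      (∑ o : P.Out, if P.producer o ∈ W ∧ ¬ (∃ t ∈ W, P.spends t o) then
        (if ¬ P.honest (P.delegatedTo o) then P.value o else 0) else 0) := by
    rw [stake_sum, stake_sum, ← Finset.sum_add_distrib, ← Finset.sum_add_distrib]
    refine Finset.sum_le_sum fun o _ => ?_
    have hv := P.value_nonneg o
    have nonW : 0 ≤ (if P.producer o ∈ W ∧ ¬ (∃ t ∈ W, P.spends t o) then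
        (if ¬ P.honest (P.delegatedTo o) then P.value o else 0) else 0) := by
      split_ifs <;> first | exact hv | exact le_rfl
    have nonK : 0 ≤ (if P.producer o ∈ K ∧ ¬ (∃ t ∈ K, P.spends t o) then P.value o else 0) := by
      split_ifs <;> first | exact hv | exact le_rfl
    have spendne : ∀ u, P.spends u o → u ≠ P.genesis := by
      rintro u hu rfl
      exact P.genesis_no_inputs o hu
    by_cases c1 : P.producer o ∈ C ∧ P.delegatedTo o ∈ A.image P.ackValidator ∧ ¬ P.SpentIn S o
    · have k1 : P.producer o ∈ K ∧ ¬ (∃ t ∈ K, P.spends t o) :=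
        ⟨hCK _ (hC _ c1.1), fun ⟨u, hu, huo⟩ =>
          c1.2.2 ⟨u, (hKS u hu (spendne u huo)).1, huo⟩⟩
      by_cases c2 : P.producer o ∈ C' ∧ P.delegatedTo o ∈ A'.image P.ackValidator ∧
          ¬ P.SpentIn S' o
      · have w1 : P.producer o ∈ W ∧ ¬ (∃ t ∈ W, P.spends t o) := by
          refine ⟨hKW _ k1.1, fun ⟨u, hu, huo⟩ => ?_⟩
          rcases hWS u hu (spendne u huo) with h | h
          · exact c1.2.2 ⟨u, h, huo⟩
          · exact c2.2.2 ⟨u, h, huo⟩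
        rw [if_pos c1, if_pos c2, if_pos k1, if_pos w1, if_pos (hdis _ c1.2.1 c2.2.1)]
      · rw [if_pos c1, if_neg c2, if_pos k1]
        linarith
    · by_cases c2 : P.producer o ∈ C' ∧ P.delegatedTo o ∈ A'.image P.ackValidator ∧
          ¬ P.SpentIn S' o
      · have k1 : P.producer o ∈ K ∧ ¬ (∃ t ∈ K, P.spends t o) :=
          ⟨hCK' _ (hC' _ c2.1), fun ⟨u, hu, huo⟩ =>
            c2.2.2 ⟨u, (hKS u hu (spendne u huo)).2, huo⟩⟩
        rw [if_neg c1, if_pos c2, if_pos k1]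
        linarith
      · rw [if_neg c1, if_neg c2]
        linarith
  rw [htot] at hmain
  have hfin := hmain.trans (add_le_add le_rfl (hadvW.trans hadvn.le))
  have hfin2 := lt_of_lt_of_le (add_lt_add hst hst') hfin
  linarith

theorem Comp.symm {P : ABC} {t t' : P.Tx} {A A' : Finset P.Ack} (h : P.Comp t A t' A') :
    P.Comp t' A' t A := Or.symm h

/-- all certificates are pairwise comparable -/
theorem comp_all (P : ABC) (E : P.Execution) (hchain : P.HonestChained) (hadv : P.AdvBounded E) :
    ∀ p q : ℕ ×ₗ ℕ, q ≤ p → ∀ (r r' : ℕ) (A A' : Finset P.Ack) (t t' : P.Tx),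
      P.Cert r A t → P.Cert r' A' t' → key E r A = p → key E r' A' = q → P.Comp t A t' A' := by
  intro p
  induction p using WellFoundedLT.induction with
  | ind p ihp =>
  intro q
  induction q using WellFoundedLT.induction with
  | ind q ihq =>
  intro hqp r r' A A' t t' hc hc' hp hq
  have H1 : ∀ s s' B B' u u', P.Cert s B u → P.Cert s' B' u' → key E s B < key E r A →
      key E s' B' < key E r A → P.Comp u B u' B' := by
    intro s s' B B' u u' h h' hk hk'
    rw [hp] at hk hk'
    rcases le_total (key E s' B') (key E s B) with hh | hh
    · exact ihp _ hk _ hh s s' B B' u u' h h' rfl rfl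
    · exact (ihp _ hk' _ hh s' s B' B u' u h' h rfl rfl).symm
  have H2 : ∀ s B u, P.Cert s B u → key E s B < key E r' A' → P.Comp t A u B := by
    intro s B u h hk
    rw [hq] at hk
    exact ihq _ hk (hk.le.trans hqp) r s A B t u hc h hp rfl
  refine comp_step P E hchain hadv r r' A A' t t' hc hc' (by rw [hp, hq]; exact hqp) H1 H2 ?_
  intro s B u h hk
  rcases lt_or_eq_of_le hqp with hlt | heq
  · exact H1 s r' B A' u t' h hc' hk (by rw [hp, hq]; exact hlt)
  · rw [hp, ← heq] at hk
    exact (ihq _ hk (hk.le.trans hqp) r' s A' B t' u hc' h (hq.trans heq) rfl).symm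

theorem confirmed_depends (P : ABC) {t u : P.Tx} (h : P.Depends t u) (ht : P.Confirmed t) :
    P.Confirmed u := by
  induction h with
  | refl => exact ht
  | tail _ h ih =>
    obtain ⟨o, ho, rfl⟩ := h
    exact P.ConfirmedIn_inputs _ _ ih o ho

theorem no_double_spend (P : ABC) (E : P.Execution) (hchain : P.HonestChained)
    (hadv : P.AdvBounded E) : ¬ P.HasDoubleSpend := by
  rintro ⟨t₁, t₂, h1, h2, u₁, u₂, d1, d2, hne, hsh⟩
  have c1 := P.confirmed_depends d1 h1
  have c2 := P.confirmed_depends d2 h2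
  have g1 : u₁ ≠ P.genesis := by
    rintro rfl
    obtain ⟨o, ho, -⟩ := hsh
    exact P.genesis_no_inputs o ho
  have g2 : u₂ ≠ P.genesis := by
    rintro rfl
    obtain ⟨o, -, ho⟩ := hsh
    exact P.genesis_no_inputs o ho
  obtain ⟨r, A, -, hc⟩ := P.confirmed_cert _ _ c1 g1
  obtain ⟨r', A', -, hc'⟩ := P.confirmed_cert _ _ c2 g2
  have hcomp : P.Comp u₁ A u₂ A' := by
    rcases le_total (key E r' A') (key E r A) with hh | hh
    · exact comp_all P E hchain hadv _ _ hh r r' A A' u₁ u₂ hc hc' rfl rfl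
    · exact (comp_all P E hchain hadv _ _ hh r' r A' A u₂ u₁ hc' hc rfl rfl).symm
  exact comp_noshare hc hc' hcomp hne hsh

end ABC

/-- STATEMENT 7 (Lemma 4 of the paper): let `G` be a minimal transaction DAG
(fewest transactions among DAGs producible by the protocol) containing two
confirmed conflicting transactions, and `t₀` the first transaction confirmed
in `G` during the execution `E`.  Then there is a DAG `G'` producible by the
protocol, in whose genesis the inputs of `t₀` are replaced with the outputs of
`t₀` — formalized by an embedding `e` of the transactions of `G'` onto the
transactions of `G` other than `t₀` sending the genesis of `G'` to the genesis
of `G`, and an embedding `eo` of the outputs of `G'` onto the outputs of `G`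
not spent by `t₀`, preserving values, delegation and the spending relation,
where the outputs of `t₀` become genesis outputs of `G'` — such that the set
of transactions confirmed in `G'` is the same as in `G` except that it does
not include `t₀`.  In particular, `G'` has fewer transactions than `G` and
still contains two confirmed conflicting transactions. -/
theorem ABC.remove_first_confirmed (G : ABC) (E : G.Execution)
    (hchain : G.HonestChained) (hnocs : G.HonestNoConflictSign)
    (hadv : G.AdvBounded E) (hds : G.HasDoubleSpend)
    (hmin : ∀ G' : ABC, G'.Producible → G'.HasDoubleSpend →
      Fintype.card G.Tx ≤ Fintype.card G'.Tx)
    (t₀ : G.Tx) (A₀ : Finset G.Ack) (hfirst : G.FirstConfirmed E t₀ A₀) :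
    ∃ (G' : ABC) (e : G'.Tx → G.Tx) (eo : G'.Out → G.Out) (ev : G'.Val ≃ G.Val),
      G'.Producible ∧
      Function.Injective e ∧ Set.range e = {t : G.Tx | t ≠ t₀} ∧
      e G'.genesis = G.genesis ∧
      Function.Injective eo ∧ Set.range eo = {o : G.Out | ¬ G.spends t₀ o} ∧
      (∀ o, G'.value o = G.value (eo o)) ∧
      (∀ o, ev (G'.delegatedTo o) = G.delegatedTo (eo o)) ∧
      (∀ v, G'.honest v ↔ G.honest (ev v)) ∧
      (∀ o, e (G'.producer o) =
        if G.producer (eo o) = t₀ then G.genesis else G.producer (eo o)) ∧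
      (∀ (t : G'.Tx) (o : G'.Out), G'.spends t o ↔ G.spends (e t) (eo o)) ∧
      G'.M = G.M ∧
      (∀ t : G'.Tx, G'.Confirmed t ↔ G.Confirmed (e t)) ∧
      Fintype.card G'.Tx < Fintype.card G.Tx ∧
      G'.HasDoubleSpend := by
  exact absurd hds (ABC.no_double_spend G E hchain hadv)
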